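/- Suppose a group G acts specially on a quasi-median graph X with exactly N orbits of hyperplanes. Let A and B be hyperplanes of X that osculate and belong to the same connected component of the crossing graph ΔX. Then d_{ΔX}(A,B) ≤ max{2, N−1}. -/

import Mathlib

namespace QM

variable {V : Type*}

/-- `y₁` and `y₂` lie (in this order) on a common geodesic from `x₁` to `x₂`. -/
def OnGeod (X : SimpleGraph V) (x₁ y₁ y₂ x₂ : V) : Prop :=
  X.dist x₁ y₁ + X.dist y₁ y₂ + X.dist y₂ x₂ = X.dist x₁ x₂

/-- `(y₁, y₂, y₃)` is a `k`-quasi-median triple for `(x₁, x₂, x₃)` (without minimality). -/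
def IsQMTriple (X : SimpleGraph V) (x₁ x₂ x₃ y₁ y₂ y₃ : V) (k : ℕ) : Prop :=
  OnGeod X x₁ y₁ y₂ x₂ ∧ OnGeod X x₁ y₁ y₃ x₃ ∧ OnGeod X x₂ y₂ y₃ x₃ ∧
    X.dist y₁ y₂ = k ∧ X.dist y₁ y₃ = k ∧ X.dist y₂ y₃ = k

/-- `y` is a quasi-median of the triple `(x₁, x₂, x₃)`: it is a `k`-quasi-median triple
with `k` as small as possible. -/
def IsQuasiMedianTriple (X : SimpleGraph V) (x₁ x₂ x₃ : V) (y : V × V × V) : Prop :=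
  ∃ k : ℕ, IsQMTriple X x₁ x₂ x₃ y.1 y.2.1 y.2.2 k ∧
    ∀ (k' : ℕ) (z₁ z₂ z₃ : V), IsQMTriple X x₁ x₂ x₃ z₁ z₂ z₃ k' → k ≤ k'

/-- The complete multipartite graph `K_{1,1,2}`: the complete graph on four vertices
with the edge between vertices `2` and `3` removed. -/
def K112 : SimpleGraph (Fin 4) :=
  SimpleGraph.fromRel (fun i j => ¬(i = 2 ∧ j = 3) ∧ ¬(i = 3 ∧ j = 2))

/-- The 1-skeleton of the 3-cube. -/
def cubeGraph : SimpleGraph (Fin 3 → Bool) :=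
  SimpleGraph.fromRel (fun x y => ∃! i, x i ≠ y i)

/-- The 6-cycle. -/
def C6 : SimpleGraph (Fin 6) := SimpleGraph.fromRel (fun i j => j = i + 1)

/-- A set of vertices is convex if it contains every vertex lying on a geodesic between
two of its members. -/
def IsConvexSet (X : SimpleGraph V) (S : Set V) : Prop :=
  ∀ x ∈ S, ∀ y ∈ S, ∀ z : V, X.dist x z + X.dist z y = X.dist x y → z ∈ S

/-- The convex hull of a set of vertices. -/
def convexHullSet (X : SimpleGraph V) (S : Set V) : Set V :=
  ⋂₀ {T : Set V | S ⊆ T ∧ IsConvexSet X T}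

/-- A quasi-median graph: a connected graph in which every triple of vertices has a unique
quasi-median, with no induced `K_{1,1,2}`, and in which the convex hull of every isometrically
embedded 6-cycle is isomorphic to the 3-cube. -/
structure IsQuasiMedian (X : SimpleGraph V) : Prop where
  connected : X.Connected
  uniqueQuasiMedian : ∀ x₁ x₂ x₃ : V, ∃! y : V × V × V, IsQuasiMedianTriple X x₁ x₂ x₃ y
  noK112 : IsEmpty (SimpleGraph.Embedding K112 X)
  hullOfC6IsCube : ∀ f : Fin 6 → V,
    (∀ i j, C6.Adj i j → X.Adj (f i) (f j)) →
    (∀ i j, X.dist (f i) (f j) = C6.dist i j) →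
    Nonempty (SimpleGraph.Iso
      (SimpleGraph.induce (convexHullSet X (Set.range f)) X) cubeGraph)

/-- Two edges are two sides of a common triangle, or opposite sides of a common square. -/
def SideRel (X : SimpleGraph V) (e f : Sym2 V) : Prop :=
  (∃ a b c : V, X.Adj a b ∧ X.Adj a c ∧ X.Adj b c ∧ e = s(a, b) ∧ f = s(a, c)) ∨
  (∃ a b c d : V, X.Adj a b ∧ X.Adj c d ∧ X.Adj a c ∧ X.Adj b d ∧ a ≠ d ∧ b ≠ c ∧
    e = s(a, b) ∧ f = s(c, d))

/-- The equivalence class of an edge under the equivalence relation generated by `SideRel`. -/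
def hypClass (X : SimpleGraph V) (e : Sym2 V) : Set (Sym2 V) :=
  {f | Relation.EqvGen (SideRel X) e f}

/-- A hyperplane: the equivalence class of some edge of `X`. -/
def IsHyperplane (X : SimpleGraph V) (H : Set (Sym2 V)) : Prop :=
  ∃ e ∈ X.edgeSet, H = hypClass X e

/-- The type of hyperplanes of `X`. -/
def Hyperplane (X : SimpleGraph V) := {H : Set (Sym2 V) // IsHyperplane X H}

/-- Edges `e`, `e'` sharing the endpoint `p`, not lying in a common clique, that are
adjacent sides of a square of `X`: their dual hyperplanes intersect at `p`. -/
def IntersectAt (X : SimpleGraph V) (e e' : Sym2 V) (p : V) : Prop :=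
  ∃ a b : V, e = s(p, a) ∧ e' = s(p, b) ∧ X.Adj p a ∧ X.Adj p b ∧ a ≠ b ∧ ¬ X.Adj a b ∧
    ∃ q : V, q ≠ p ∧ X.Adj a q ∧ X.Adj b q

/-- Edges `e`, `e'` sharing the endpoint `p`, not lying in a common clique, and not adjacent
sides of any square of `X`: their dual hyperplanes osculate at `p`. -/
def OsculateAt (X : SimpleGraph V) (e e' : Sym2 V) (p : V) : Prop :=
  ∃ a b : V, e = s(p, a) ∧ e' = s(p, b) ∧ X.Adj p a ∧ X.Adj p b ∧ a ≠ b ∧ ¬ X.Adj a b ∧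
    ¬ ∃ q : V, q ≠ p ∧ X.Adj a q ∧ X.Adj b q

/-- Hyperplanes `H` and `H'` intersect at `p`. -/
def HypIntersectAt (X : SimpleGraph V) (H H' : Hyperplane X) (p : V) : Prop :=
  ∃ e ∈ H.1, ∃ e' ∈ H'.1, IntersectAt X e e' p

/-- Hyperplanes `H` and `H'` osculate at `p`. -/
def HypOsculateAt (X : SimpleGraph V) (H H' : Hyperplane X) (p : V) : Prop :=
  ∃ e ∈ H.1, ∃ e' ∈ H'.1, OsculateAt X e e' p

/-- Hyperplanes `H` and `H'` intersect. -/
def HypIntersect (X : SimpleGraph V) (H H' : Hyperplane X) : Prop :=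
  ∃ p : V, HypIntersectAt X H H' p

/-- Hyperplanes `H` and `H'` osculate. -/
def HypOsculate (X : SimpleGraph V) (H H' : Hyperplane X) : Prop :=
  ∃ p : V, HypOsculateAt X H H' p

/-- The contact graph `𝒞X`: hyperplanes are adjacent iff they intersect or osculate. -/
def contactGraph (X : SimpleGraph V) : SimpleGraph (Hyperplane X) :=
  SimpleGraph.fromRel (fun H H' => HypIntersect X H H' ∨ HypOsculate X H H')

/-- The crossing graph `ΔX`: hyperplanes are adjacent iff they intersect. -/
def crossingGraph (X : SimpleGraph V) : SimpleGraph (Hyperplane X) :=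
  SimpleGraph.fromRel (fun H H' => HypIntersect X H H')

/-- The (vertex set of the) carrier of a hyperplane: all endpoints of its edges. -/
def hypCarrier (X : SimpleGraph V) (H : Hyperplane X) : Set V :=
  {v : V | ∃ e ∈ H.1, v ∈ e}

/-- A set of edges `H` (e.g. a hyperplane) separates `p` from `q` if every walk from `p`
to `q` uses an edge of `H`. -/
def Separates (X : SimpleGraph V) (H : Set (Sym2 V)) (p q : V) : Prop :=
  ∀ w : X.Walk p q, ∃ e ∈ w.edges, e ∈ H

/-- `f` is a `(λ, c)`-quasi-isometry from `(A, dA)` to `(B, dB)`. -/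
def IsQuasiIsometry {A B : Type*} (lam c : ℝ) (dA : A → A → ℝ) (dB : B → B → ℝ)
    (f : A → B) : Prop :=
  (∀ x y : A, dA x y / lam - c ≤ dB (f x) (f y) ∧ dB (f x) (f y) ≤ lam * dA x y + c) ∧
    ∀ b : B, ∃ a : A, dB (f a) b ≤ c

end QM

namespace QM

variable {V : Type*} {G : Type*} [Group G]

/-- An action of a group `G` on a graph `X` by graph automorphisms. -/
structure GraphAction (G : Type*) [Group G] {V : Type*} (X : SimpleGraph V) where
  act : G → V → V
  act_one : ∀ v, act 1 v = v
  act_mul : ∀ g h v, act (g * h) v = act g (act h v)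
  act_adj : ∀ g a b, X.Adj (act g a) (act g b) ↔ X.Adj a b

/-- The image of a set of edges under the action of `g`. -/
def GraphAction.hypImage {X : SimpleGraph V} (α : GraphAction G X) (g : G)
    (H : Set (Sym2 V)) : Set (Sym2 V) :=
  Sym2.map (α.act g) '' H

/-- Two hyperplanes are in the same orbit of the induced action of `G` on hyperplanes. -/
def SameOrbit {X : SimpleGraph V} (α : GraphAction G X) (H H' : Hyperplane X) : Prop :=
  ∃ g : G, H'.1 = α.hypImage g H.1

/-- The set of `G`-orbits of hyperplanes. -/
def HypOrbit {X : SimpleGraph V} (α : GraphAction G X) := Quot (SameOrbit α)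

/-- The quotient graph `ΔX/G`: vertices are `G`-orbits of hyperplanes, two orbits being
adjacent iff some representatives are adjacent in the crossing graph `ΔX`. -/
def quotCrossingGraph {X : SimpleGraph V} (α : GraphAction G X) :
    SimpleGraph (HypOrbit α) :=
  SimpleGraph.fromRel (fun O O' => ∃ H H' : Hyperplane X,
    Quot.mk (SameOrbit α) H = O ∧ Quot.mk (SameOrbit α) H' = O' ∧ (crossingGraph X).Adj H H')

/-- Every vertex of the quotient graph `ΔX/G` has at most `D` neighbours. -/
def QuotDegBounded {X : SimpleGraph V} (α : GraphAction G X) (D : ℕ) : Prop :=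
  ∀ O : HypOrbit α, ((quotCrossingGraph α).neighborSet O).Finite ∧
    ((quotCrossingGraph α).neighborSet O).ncard ≤ D

/-- The action is special: (i) no two distinct hyperplanes in the same `G`-orbit intersect
or osculate; (ii) if two hyperplanes intersect, then no `G`-translate of the first osculates
with the second. -/
def IsSpecial {X : SimpleGraph V} (α : GraphAction G X) : Prop :=
  (∀ H H' : Hyperplane X, SameOrbit α H H' → H ≠ H' →
      ¬(HypIntersect X H H' ∨ HypOsculate X H H')) ∧
  (∀ H H' K : Hyperplane X, HypIntersect X H H' → SameOrbit α H K →
      ¬ HypOsculate X K H')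

/-- The `g`-translate of the hyperplane `A` is within contact-graph distance `ε` of `A`. -/
def TranslateDistLE {X : SimpleGraph V} (α : GraphAction G X) (g : G)
    (A : Hyperplane X) (ε : ℝ) : Prop :=
  ∃ A' : Hyperplane X, A'.1 = α.hypImage g A.1 ∧ ((contactGraph X).dist A A' : ℝ) ≤ ε

end QM

namespace QM

section Metric

variable {V : Type*} {X : SimpleGraph V}

lemma dist_le_succ_of_adj (hc : X.Connected) (u : V) {v w : V} (h : X.Adj v w) :
    X.dist u v ≤ X.dist u w + 1 := by
  have h₁ := hc.dist_triangle (u := u) (v := w) (w := v)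
  rwa [SimpleGraph.dist_eq_one_iff_adj.2 h.symm] at h₁

lemma exists_adj_dist_succ (hc : X.Connected) {u v : V} (h : u ≠ v) :
    ∃ w, X.Adj v w ∧ X.dist u w + 1 = X.dist u v := by
  obtain ⟨W, hW⟩ := hc.exists_walk_length_eq_dist v u
  cases W with
  | nil => exact absurd rfl h
  | @cons _ w _ hvw W' =>
    refine ⟨w, hvw, ?_⟩
    have h₁ := SimpleGraph.dist_le W'
    have h₂ := dist_le_succ_of_adj hc u hvw
    rw [SimpleGraph.Walk.length_cons, SimpleGraph.dist_comm] at hW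
    rw [SimpleGraph.dist_comm] at h₁
    omega

/-- Two triangles sharing an edge span a clique. -/
lemma IsQuasiMedian.adj_of_two_triangles (hX : IsQuasiMedian X) {a b c d : V}
    (hab : X.Adj a b) (hac : X.Adj a c) (had : X.Adj a d) (hbc : X.Adj b c)
    (hbd : X.Adj b d) (hcd : c ≠ d) : X.Adj c d := by
  by_contra hn
  refine hX.noK112.false ⟨⟨![a, b, c, d], ?_⟩, ?_⟩
  · intro i j hij
    have := hab.ne; have := hac.ne; have := had.ne; have := hbc.ne; have := hbd.ne
    fin_cases i <;> fin_cases j <;> simp_all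
  · intro i j
    have hn' : ¬ X.Adj d c := fun h => hn h.symm
    change X.Adj (![a, b, c, d] i) (![a, b, c, d] j) ↔ _
    fin_cases i <;> fin_cases j <;>
      simp [K112, hab, hac, had, hbc, hbd, hn, hn', hab.symm, hac.symm, had.symm, hbc.symm,
        hbd.symm]

/-- The triangle condition. -/
lemma IsQuasiMedian.triangle (hX : IsQuasiMedian X) {u v w : V} (hvw : X.Adj v w)
    (h : X.dist u v = X.dist u w) :
    ∃ z, X.Adj v z ∧ X.Adj w z ∧ X.dist u z + 1 = X.dist u v := by
  have hc := hX.connected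
  obtain ⟨⟨u', v', w'⟩, ⟨k, ⟨h₁, h₂, h₃, e₁, e₂, e₃⟩, -⟩, -⟩ := hX.uniqueQuasiMedian u v w
  simp only [OnGeod] at h₁ h₂ h₃ e₁ e₂ e₃
  rw [SimpleGraph.dist_eq_one_iff_adj.2 hvw] at h₃
  rw [SimpleGraph.dist_comm (u := v') (v := v)] at h₁
  have hk : k = 1 := by omega
  have hv : v = v' := hc.dist_eq_zero_iff.1 (by omega)
  have hw : w' = w := hc.dist_eq_zero_iff.1 (by omega)
  subst hk hv hw
  refine ⟨u', (SimpleGraph.dist_eq_one_iff_adj.1 e₁).symm,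
    (SimpleGraph.dist_eq_one_iff_adj.1 e₂).symm, ?_⟩
  simp only [SimpleGraph.dist_self] at h₁
  omega

/-- An edge of a clique is not equidistant from a vertex to which a third vertex of the clique
is strictly farther. -/
lemma IsQuasiMedian.dist_ne_of_clique (hX : IsQuasiMedian X) {u a b c : V} (hab : X.Adj a b)
    (hac : X.Adj a c) (hbc : X.Adj b c) (hc : X.dist u c = X.dist u a + 1) :
    X.dist u a ≠ X.dist u b := by
  intro h
  obtain ⟨r, har, hbr, hr⟩ := hX.triangle hab h
  have hcr : c ≠ r := by rintro rfl; omega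
  have := hX.adj_of_two_triangles hab hac har hbc hbr hcr
  have := dist_le_succ_of_adj hX.connected u this
  omega

lemma cubeGraph_adj_iff (x y : Fin 3 → Bool) : cubeGraph.Adj x y ↔
    (x 0 ≠ y 0 ∧ x 1 = y 1 ∧ x 2 = y 2) ∨ (x 0 = y 0 ∧ x 1 ≠ y 1 ∧ x 2 = y 2) ∨
      (x 0 = y 0 ∧ x 1 = y 1 ∧ x 2 ≠ y 2) := by
  have key : ∀ a b : Fin 3 → Bool, (∃! i, a i ≠ b i) ↔
      (a 0 ≠ b 0 ∧ a 1 = b 1 ∧ a 2 = b 2) ∨ (a 0 = b 0 ∧ a 1 ≠ b 1 ∧ a 2 = b 2) ∨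
      (a 0 = b 0 ∧ a 1 = b 1 ∧ a 2 ≠ b 2) := by
    intro a b
    simp only [ExistsUnique, Fin.exists_fin_succ, Fin.forall_fin_succ]
    simp
    grind
  rw [cubeGraph, SimpleGraph.fromRel_adj, key, key]
  constructor
  · grind
  · intro h
    refine ⟨?_, Or.inl h⟩
    rintro rfl
    simp at h

set_option synthInstance.maxSize 2000 in
set_option synthInstance.maxHeartbeats 400000 in
set_option maxRecDepth 10000 in
lemma cubeGraph_two_steps {x m y : Fin 3 → Bool} (h₁ : cubeGraph.Adj x m)
    (h₂ : cubeGraph.Adj m y) (hne : x ≠ y) :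
    (x 0 ≠ y 0 ∧ x 1 ≠ y 1 ∧ x 2 = y 2) ∨ (x 0 = y 0 ∧ x 1 ≠ y 1 ∧ x 2 ≠ y 2) ∨
      (x 0 ≠ y 0 ∧ x 1 = y 1 ∧ x 2 ≠ y 2) := by
  rw [cubeGraph_adj_iff] at h₁ h₂
  have hne' : ¬ (x 0 = y 0 ∧ x 1 = y 1 ∧ x 2 = y 2) := by
    rintro ⟨h0, h1, h2⟩
    apply hne
    ext i
    fin_cases i <;> simp_all
  clear hne
  generalize x 0 = x0 at *
  generalize x 1 = x1 at *
  generalize x 2 = x2 at *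
  generalize y 0 = y0 at *
  generalize y 1 = y1 at *
  generalize y 2 = y2 at *
  generalize m 0 = m0 at *
  generalize m 1 = m1 at *
  generalize m 2 = m2 at *
  revert x0 x1 x2 y0 y1 y2 m0 m1 m2
  decide

set_option synthInstance.maxSize 2000 in
set_option synthInstance.maxHeartbeats 400000 in
set_option maxRecDepth 10000 in
lemma cubeGraph_exists_common_neighbor {x y z m₁ m₂ m₃ : Fin 3 → Bool}
    (h₁ : cubeGraph.Adj x m₁) (h₁' : cubeGraph.Adj m₁ y) (h₂ : cubeGraph.Adj y m₂)
    (h₂' : cubeGraph.Adj m₂ z) (h₃ : cubeGraph.Adj z m₃) (h₃' : cubeGraph.Adj m₃ x)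
    (hxy : x ≠ y) (hyz : y ≠ z) (hzx : z ≠ x) :
    ∃ c, cubeGraph.Adj x c ∧ cubeGraph.Adj y c ∧ cubeGraph.Adj z c := by
  have e₁ := cubeGraph_two_steps h₁ h₁' hxy
  have e₂ := cubeGraph_two_steps h₂ h₂' hyz
  have e₃ := cubeGraph_two_steps h₃ h₃' hzx
  clear h₁ h₁' h₂ h₂' h₃ h₃' hxy hyz hzx
  refine ⟨fun i => (x i && y i) || (y i && z i) || (z i && x i), ?_⟩
  simp only [cubeGraph_adj_iff]
  generalize x 0 = x0 at *
  generalize x 1 = x1 at *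
  generalize x 2 = x2 at *
  generalize y 0 = y0 at *
  generalize y 1 = y1 at *
  generalize y 2 = y2 at *
  generalize z 0 = z0 at *
  generalize z 1 = z1 at *
  generalize z 2 = z2 at *
  revert x0 x1 x2 y0 y1 y2 z0 z1 z2
  decide

lemma C6_adj_succ (i : Fin 6) : C6.Adj i (i + 1) := by
  rw [C6, SimpleGraph.fromRel_adj]
  revert i
  decide

/-- A closed hexagon in `X` whose vertices are at the same mutual distances as in the
6-cycle is isometrically embedded. -/
lemma dist_eq_C6_dist (f : Fin 6 → V)
    (hadj : ∀ i j, C6.Adj i j → X.Adj (f i) (f j))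
    (h2 : ∀ i, X.dist (f i) (f (i + 2)) = 2) (h3 : ∀ i, X.dist (f i) (f (i + 3)) = 3)
    (i j : Fin 6) : X.dist (f i) (f j) = C6.dist i j := by
  have hs : ∀ i : Fin 6, C6.Reachable i (i + 1) := fun i => (C6_adj_succ i).reachable
  have hC : C6.Connected := by
    have h0 : ∀ i : Fin 6, C6.Reachable 0 i := by
      intro i
      have h1 := hs 0
      have h2 := h1.trans (hs 1)
      have h3 := h2.trans (hs 2)
      have h4 := h3.trans (hs 3)
      have h5 := h4.trans (hs 4)
      fin_cases i
      exacts [.rfl, h1, h2, h3, h4, h5]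
    exact ⟨fun a b => (h0 a).symm.trans (h0 b)⟩
  have hle : ∀ i j, X.dist (f i) (f j) ≤ C6.dist i j := by
    intro i j
    obtain ⟨W, hW⟩ := hC.exists_walk_length_eq_dist i j
    let F : C6 →g X := ⟨f, fun {a b} h => hadj a b h⟩
    have := SimpleGraph.dist_le (W.map F)
    rw [SimpleGraph.Walk.length_map, hW] at this
    exact this
  have c1 : ∀ i : Fin 6, C6.dist i (i + 1) = 1 := fun i =>
    SimpleGraph.dist_eq_one_iff_adj.2 (C6_adj_succ i)
  have c2 : ∀ i : Fin 6, C6.dist i (i + 2) ≤ 2 := by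
    intro i
    have := hC.dist_triangle (u := i) (v := i + 1) (w := i + 1 + 1)
    rw [c1, c1] at this
    rwa [show i + 2 = i + 1 + 1 by rw [add_assoc]; rfl]
  have c3 : ∀ i : Fin 6, C6.dist i (i + 3) ≤ 3 := by
    intro i
    have := hC.dist_triangle (u := i) (v := i + 2) (w := i + 2 + 1)
    rw [c1] at this
    have := c2 i
    rw [show i + 3 = i + 2 + 1 by rw [add_assoc]; rfl]
    omega
  have hge : ∀ i k : Fin 6, k ≤ 3 → C6.dist i (i + k) ≤ X.dist (f i) (f (i + k)) := by
    intro i k hk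
    obtain rfl | rfl | rfl | rfl : k = 0 ∨ k = 1 ∨ k = 2 ∨ k = 3 := by
      revert k; decide
    · simp
    · rw [c1, SimpleGraph.dist_eq_one_iff_adj.2 (hadj _ _ (C6_adj_succ i))]
    · rw [h2]; exact c2 i
    · rw [h3]; exact c3 i
  refine le_antisymm (hle i j) ?_
  have hij : (∃ k : Fin 6, k ≤ 3 ∧ j = i + k) ∨ ∃ k : Fin 6, k ≤ 3 ∧ i = j + k := by
    revert i j; decide
  rcases hij with ⟨k, hk, rfl⟩ | ⟨k, hk, rfl⟩
  · exact hge i k hk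
  · rw [SimpleGraph.dist_comm, SimpleGraph.dist_comm (u := f (j + k))]
    exact hge j k hk

/-- Alternate vertices of an isometric hexagon have a common neighbor. -/
lemma IsQuasiMedian.exists_common_neighbor_of_hexagon (hX : IsQuasiMedian X)
    {a b c d e f : V} (hab : X.Adj a b) (hbc : X.Adj b c) (hcd : X.Adj c d) (hde : X.Adj d e)
    (hef : X.Adj e f) (hfa : X.Adj f a) (hac : X.dist a c = 2) (hbd : X.dist b d = 2)
    (hce : X.dist c e = 2) (hdf : X.dist d f = 2) (hea : X.dist e a = 2)
    (hfb : X.dist f b = 2) (had : X.dist a d = 3) (hbe : X.dist b e = 3)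
    (hcf : X.dist c f = 3) : ∃ z, X.Adj a z ∧ X.Adj c z ∧ X.Adj e z := by
  let g : Fin 6 → V := ![a, b, c, d, e, f]
  have hsucc : ∀ i : Fin 6, X.Adj (g i) (g (i + 1)) := by
    intro i; fin_cases i
    exacts [hab, hbc, hcd, hde, hef, hfa]
  have hadj : ∀ i j, C6.Adj i j → X.Adj (g i) (g j) := by
    intro i j h
    rw [C6, SimpleGraph.fromRel_adj] at h
    rcases h.2 with rfl | rfl
    · exact hsucc i
    · exact (hsucc j).symm
  have h2 : ∀ i, X.dist (g i) (g (i + 2)) = 2 := by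
    intro i; fin_cases i
    exacts [hac, hbd, hce, hdf, hea, hfb]
  have h3 : ∀ i, X.dist (g i) (g (i + 3)) = 3 := by
    intro i; fin_cases i
    exacts [had, hbe, hcf, (SimpleGraph.dist_comm).trans had, (SimpleGraph.dist_comm).trans hbe,
      (SimpleGraph.dist_comm).trans hcf]
  obtain ⟨φ⟩ := hX.hullOfC6IsCube g hadj (dist_eq_C6_dist g hadj h2 h3)
  have hmem : ∀ i, g i ∈ convexHullSet X (Set.range g) := fun i =>
    Set.mem_sInter.2 fun T hT => hT.1 ⟨i, rfl⟩
  let y : Fin 6 → Fin 3 → Bool := fun i => φ ⟨g i, hmem i⟩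
  have hy : ∀ i, cubeGraph.Adj (y i) (y (i + 1)) := fun i =>
    φ.map_adj_iff.2 (by simpa using hsucc i)
  have hne : ∀ i, y i ≠ y (i + 2) := by
    intro i h
    have h' : g i = g (i + 2) := congrArg Subtype.val (φ.injective h)
    have := h2 i
    rw [h', SimpleGraph.dist_self] at this
    omega
  obtain ⟨z, hz₁, hz₂, hz₃⟩ := cubeGraph_exists_common_neighbor (hy 0) (hy 1) (hy 2) (hy 3)
    (hy 4) (hy 5) (hne 0) (hne 2) (hne 4)
  obtain ⟨z, rfl⟩ := φ.surjective z
  have key : ∀ i, cubeGraph.Adj (y i) (φ z) → X.Adj (g i) z := by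
    intro i h
    simpa using φ.map_adj_iff.1 h
  exact ⟨z, key 0 hz₁, key 2 hz₂, key 4 hz₃⟩

/-- The quadrangle condition at distance two. -/
lemma IsQuasiMedian.quadrangle_of_dist_two (hX : IsQuasiMedian X) {u v w x : V}
    (hxv : X.Adj x v) (hxw : X.Adj x w) (hvw : X.dist v w = 2) (hv : X.dist u v = 2)
    (hw : X.dist u w = 2) (hx : X.dist u x = 3) :
    ∃ z, X.Adj u z ∧ X.Adj v z ∧ X.Adj w z := by
  have hc := hX.connected
  by_contra hno
  have hnbr : ∀ {v w : V}, X.Adj x v → X.Adj x w → X.dist u v = 2 → X.dist u w = 2 →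
      (¬ ∃ z, X.Adj u z ∧ X.Adj v z ∧ X.Adj w z) → X.dist v w = 2 →
      ∃ s, X.Adj u s ∧ X.Adj s v ∧ X.dist s w = 3 ∧ X.dist s x = 2 := by
    intro v w hxv hxw hv hw hno hvw
    have huv : u ≠ v := by rintro rfl; simp at hv
    obtain ⟨s, hvs, hs⟩ := exists_adj_dist_succ hc huv
    have hus : X.Adj u s := SimpleGraph.dist_eq_one_iff_adj.1 (by omega)
    have d₁ := dist_le_succ_of_adj hc s hxv
    have d₁' := dist_le_succ_of_adj hc x hus
    rw [SimpleGraph.dist_eq_one_iff_adj.2 hvs.symm] at d₁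
    rw [SimpleGraph.dist_comm (u := x) (v := u), hx, SimpleGraph.dist_comm (u := x)] at d₁'
    have hsx : X.dist s x = 2 := by omega
    have d₂ := dist_le_succ_of_adj hc s hxw.symm
    have d₃ := dist_le_succ_of_adj hc s hxw
    have hsw₁ : X.dist s w ≠ 1 := fun h => hno
      ⟨s, hus, hvs, (SimpleGraph.dist_eq_one_iff_adj.1 h).symm⟩
    have hsw₂ : X.dist s w ≠ 2 := by
      intro h
      obtain ⟨r, hxr, hwr, hr⟩ := hX.triangle hxw (hsx.trans h.symm)
      have hsr : X.Adj s r := SimpleGraph.dist_eq_one_iff_adj.1 (by omega)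
      have d₄ := dist_le_succ_of_adj hc u hxr
      have d₅ := dist_le_succ_of_adj hc u hsr.symm
      exact hX.dist_ne_of_clique (u := u) hwr hxw.symm hxr.symm (by omega) (by omega)
    exact ⟨s, hus, hvs.symm, by omega, hsx⟩
  obtain ⟨s, hus, hsv, hsw, hsx⟩ := hnbr hxv hxw hv hw hno hvw
  obtain ⟨t, hut, htw, htv, htx⟩ := hnbr hxw hxv hw hv
    (fun ⟨z, h₁, h₂, h₃⟩ => hno ⟨z, h₁, h₃, h₂⟩) (SimpleGraph.dist_comm.trans hvw)
  have hts : X.dist t s = 2 := by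
    have d₁ := dist_le_succ_of_adj hc t hus.symm
    have d₂ := dist_le_succ_of_adj hc t hsv.symm
    rw [SimpleGraph.dist_eq_one_iff_adj.2 hut.symm] at d₁
    omega
  exact hno (hX.exists_common_neighbor_of_hexagon hus hsv hxv.symm hxw htw.symm hut.symm hv hsx
    hvw (SimpleGraph.dist_comm.trans htx) (SimpleGraph.dist_comm.trans hw) hts hx hsw
    (SimpleGraph.dist_comm.trans htv))

/-- The quadrangle condition. -/
lemma IsQuasiMedian.quadrangle (hX : IsQuasiMedian X) {u v w x : V} (hxv : X.Adj x v)
    (hxw : X.Adj x w) (hne : v ≠ w) (hnadj : ¬ X.Adj v w) (hv : X.dist u x = X.dist u v + 1)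
    (hw : X.dist u x = X.dist u w + 1) :
    ∃ z, X.Adj v z ∧ X.Adj w z ∧ X.dist u z + 1 = X.dist u v := by
  have hc := hX.connected
  have hvw : X.dist v w = 2 := by
    have h₁ := dist_le_succ_of_adj hc v hxw.symm
    rw [SimpleGraph.dist_eq_one_iff_adj.2 hxv.symm] at h₁
    have h₂ : X.dist v w ≠ 0 := fun h => hne (hc.dist_eq_zero_iff.1 h)
    have h₃ : X.dist v w ≠ 1 := fun h => hnadj (SimpleGraph.dist_eq_one_iff_adj.1 h)
    omega
  obtain ⟨⟨u', v', w'⟩, ⟨k, ⟨h₁, h₂, h₃, e₁, e₂, e₃⟩, -⟩, -⟩ := hX.uniqueQuasiMedian u v w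
  simp only [OnGeod] at h₁ h₂ h₃ e₁ e₂ e₃
  rw [SimpleGraph.dist_comm (u := v') (v := v)] at h₁
  obtain rfl | rfl : k = 0 ∨ k = 2 := by omega
  · obtain rfl := hc.dist_eq_zero_iff.1 e₁
    obtain rfl := hc.dist_eq_zero_iff.1 e₂
    have hv' : X.dist v u' = 1 := by omega
    have hw' : X.dist u' w = 1 := by omega
    exact ⟨u', SimpleGraph.dist_eq_one_iff_adj.1 hv',
      (SimpleGraph.dist_eq_one_iff_adj.1 hw').symm, by omega⟩
  · obtain rfl : v = v' := hc.dist_eq_zero_iff.1 (by omega)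
    obtain rfl : w' = w := hc.dist_eq_zero_iff.1 (by omega)
    simp only [SimpleGraph.dist_self] at h₁
    have d₁ := hc.dist_triangle (u := u) (v := u') (w := x)
    have d₂ := dist_le_succ_of_adj hc u' hxv
    obtain ⟨z, hz, hvz, hwz⟩ := hX.quadrangle_of_dist_two hxv hxw hvw e₁ e₂ (by omega)
    have d₃ := dist_le_succ_of_adj hc u hz.symm
    have d₄ := dist_le_succ_of_adj hc u hvz
    exact ⟨z, hvz, hwz, by omega⟩

end Metric

section Hyperplanes

variable {V : Type*} {X : SimpleGraph V}

/-- Parallel edges facing each other belong to the same hyperplane. -/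
lemma IsQuasiMedian.eqvGen_of_facing (hX : IsQuasiMedian X) {c c' : V} (hcc : X.Adj c c') :
    ∀ (m : ℕ) {x y : V}, X.Adj x y → X.dist c x = m → X.dist c' y = m →
      X.dist c' x = m + 1 → X.dist c y = m + 1 →
      Relation.EqvGen (SideRel X) s(c, c') s(x, y) := by
  have hc := hX.connected
  intro m
  induction m with
  | zero =>
    intro x y _ h₁ h₂ _ _
    rw [hc.dist_eq_zero_iff.1 h₁, hc.dist_eq_zero_iff.1 h₂]
    exact .refl _
  | succ m ih =>
    intro x y hxy h₁ h₂ h₃ h₄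
    have hne : c ≠ x := by rintro rfl; simp at h₁
    obtain ⟨x₁, hxx, hx⟩ := exists_adj_dist_succ hc hne
    have d₁ := dist_le_succ_of_adj hc c' hxx
    have d₂ := hc.dist_triangle (u := c') (v := c) (w := x₁)
    rw [SimpleGraph.dist_eq_one_iff_adj.2 hcc.symm] at d₂
    have hxy₁ : x₁ ≠ y := by rintro rfl; omega
    have hnadj : ¬ X.Adj x₁ y := by
      intro h
      have := dist_le_succ_of_adj hc c h.symm
      omega
    obtain ⟨z, hxz, hyz, hz⟩ := hX.quadrangle hxx hxy hxy₁ hnadj (u := c') (by omega) (by omega)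
    have d₃ := dist_le_succ_of_adj hc c hyz
    have d₄ := dist_le_succ_of_adj hc c hxz.symm
    have hxz' : x ≠ z := by rintro rfl; omega
    refine (ih hxz (by omega) (by omega) (by omega) (by omega)).trans _ _ _
      (.symm _ _ (.rel _ _ (Or.inr ⟨x, y, x₁, z, hxy, hxz, hxx, hyz, hxz', hxy₁.symm, rfl, rfl⟩)))

/-- The edges leaving the set of vertices closer to one endpoint of a given edge than to the
other are all dual to the hyperplane of that edge. -/
lemma IsQuasiMedian.eqvGen_of_leaving (hX : IsQuasiMedian X) {c c' x y : V}
    (hcc : X.Adj c c') (hxy : X.Adj x y) (hx : X.dist c' x = X.dist c x + 1)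
    (hy : X.dist c' y ≠ X.dist c y + 1) :
    Relation.EqvGen (SideRel X) s(c, c') s(x, y) := by
  have hc := hX.connected
  have b₁ := dist_le_succ_of_adj hc c hxy
  have b₂ := dist_le_succ_of_adj hc c hxy.symm
  have b₃ := dist_le_succ_of_adj hc c' hxy
  have b₄ := dist_le_succ_of_adj hc c' hxy.symm
  have b₅ := dist_le_succ_of_adj hc y hcc
  have b₆ := dist_le_succ_of_adj hc y hcc.symm
  rw [SimpleGraph.dist_comm, SimpleGraph.dist_comm (u := y)] at b₅ b₆
  by_cases h : X.dist c y = X.dist c' y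
  · obtain ⟨d, hcd, hcd', hd⟩ := hX.triangle (u := y) hcc
      (SimpleGraph.dist_comm.trans (h.trans SimpleGraph.dist_comm))
    have key := hX.dist_ne_of_clique (u := x) hcd hcc hcd'.symm
      (by rw [SimpleGraph.dist_comm, hx, SimpleGraph.dist_comm])
    have b₇ := dist_le_succ_of_adj hc x hcd
    have b₈ := dist_le_succ_of_adj hc x hcd.symm
    have b₉ := dist_le_succ_of_adj hc d hxy
    have b₁₀ := dist_le_succ_of_adj hc x hcd'
    rw [SimpleGraph.dist_comm (u := y), SimpleGraph.dist_comm (u := y)] at hd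
    rw [SimpleGraph.dist_comm (u := x), SimpleGraph.dist_comm (u := x)] at key b₇ b₈ b₁₀
    refine Relation.EqvGen.trans _ _ _
      (.rel _ _ (Or.inl ⟨c, c', d, hcc, hcd, hcd', rfl, rfl⟩))
      (hX.eqvGen_of_facing hcd (X.dist c x) hxy rfl ?_ ?_ ?_) <;> omega
  · exact hX.eqvGen_of_facing hcc (X.dist c x) hxy rfl (by omega) hx (by omega)

/-- A hyperplane separates the endpoints of a geodesic whose last edge is dual to it. -/
lemma IsQuasiMedian.not_reachable_deleteEdges (hX : IsQuasiMedian X) {p c c' : V}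
    (hcc : X.Adj c c') (hp : X.dist p c' = X.dist p c + 1) :
    ¬ (X.deleteEdges (hypClass X s(c, c'))).Reachable p c' := by
  rintro ⟨W⟩
  have key : ∀ {x y : V}, (X.deleteEdges (hypClass X s(c, c'))).Walk x y →
      X.dist c' x = X.dist c x + 1 → X.dist c' y = X.dist c y + 1 := by
    intro x y W
    induction W with
    | nil => exact id
    | cons h _ ih =>
      intro hx
      rw [SimpleGraph.deleteEdges_adj] at h
      refine ih ?_
      by_contra hy
      exact h.2 (hX.eqvGen_of_leaving hcc h.1 hx hy)
  have := key W (by rw [SimpleGraph.dist_comm, hp, SimpleGraph.dist_comm])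
  simp at this

lemma eqvGen_sideRel_mem_edgeSet {e f : Sym2 V} (h : Relation.EqvGen (SideRel X) e f) :
    e ∈ X.edgeSet ↔ f ∈ X.edgeSet := by
  induction h with
  | rel e f h =>
    rcases h with ⟨a, b, c, h₁, h₂, -, rfl, rfl⟩ | ⟨a, b, c, d, h₁, h₂, -, -, -, -, rfl, rfl⟩ <;>
      simp [h₁, h₂]
  | refl => rfl
  | symm _ _ _ ih => exact ih.symm
  | trans _ _ _ _ _ ih₁ ih₂ => exact ih₁.trans ih₂

lemma Hyperplane.mem_edgeSet (H : Hyperplane X) {e : Sym2 V} (he : e ∈ H.1) :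
    e ∈ X.edgeSet := by
  obtain ⟨_, f, hf, rfl⟩ := H
  exact (eqvGen_sideRel_mem_edgeSet he).1 hf

lemma Hyperplane.mem_of_eqvGen (H : Hyperplane X) {e f : Sym2 V} (he : e ∈ H.1)
    (h : Relation.EqvGen (SideRel X) e f) : f ∈ H.1 := by
  obtain ⟨_, _, _, rfl⟩ := H
  exact Relation.EqvGen.trans _ _ _ he h

lemma Hyperplane.eq_of_mem {H K : Hyperplane X} {e : Sym2 V} (hH : e ∈ H.1) (hK : e ∈ K.1) :
    H = K := by
  obtain ⟨_, f, _, rfl⟩ := H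
  obtain ⟨_, f', _, rfl⟩ := K
  apply Subtype.ext
  ext g
  have hff' : Relation.EqvGen (SideRel X) f f' := hH.trans _ _ _ (hK.symm _ _)
  exact ⟨fun h => (hff'.symm _ _).trans _ _ _ h, fun h => hff'.trans _ _ _ h⟩

lemma HypIntersect.symm {H K : Hyperplane X} (h : HypIntersect X H K) : HypIntersect X K H := by
  obtain ⟨p, e, he, e', he', a, b, h₁, h₂, ha, hb, hab, hn, q, hq, haq, hbq⟩ := h
  exact ⟨p, e', he', e, he, b, a, h₂, h₁, hb, ha, hab.symm, fun h => hn h.symm, q, hq, hbq, haq⟩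

lemma HypIntersect.exists_mem_hypCarrier {H K : Hyperplane X} (h : HypIntersect X H K) :
    ∃ v, v ∈ hypCarrier X H ∧ v ∈ hypCarrier X K := by
  obtain ⟨p, e, he, e', he', a, b, rfl, rfl, -⟩ := h
  exact ⟨p, ⟨_, he, Sym2.mem_mk_left _ _⟩, ⟨_, he', Sym2.mem_mk_left _ _⟩⟩

lemma Hyperplane.exists_adj_of_mem_hypCarrier {H : Hyperplane X} {v : V}
    (h : v ∈ hypCarrier X H) : ∃ a, X.Adj v a ∧ s(v, a) ∈ H.1 := by
  obtain ⟨e, he, a, rfl⟩ := h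
  exact ⟨a, H.mem_edgeSet he, he⟩

/-- Edges at a common vertex dual to distinct hyperplanes do not lie in a common clique. -/
lemma Hyperplane.not_adj_of_ne {H K : Hyperplane X} (hne : H ≠ K) {v a b : V}
    (ha : s(v, a) ∈ H.1) (hb : s(v, b) ∈ K.1) : a ≠ b ∧ ¬ X.Adj a b := by
  refine ⟨?_, fun hab => hne (Hyperplane.eq_of_mem (H.mem_of_eqvGen ha (.rel _ _ ?_)) hb)⟩
  · rintro rfl
    exact hne (Hyperplane.eq_of_mem ha hb)
  · exact Or.inl ⟨v, a, b, H.mem_edgeSet ha, K.mem_edgeSet hb, hab, rfl, rfl⟩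

/-- Distinct hyperplanes whose carriers meet intersect or osculate. -/
lemma intersect_or_osculate {H K : Hyperplane X} (hne : H ≠ K) {v : V}
    (hH : v ∈ hypCarrier X H) (hK : v ∈ hypCarrier X K) :
    HypIntersect X H K ∨ HypOsculate X H K := by
  obtain ⟨a, hva, ha⟩ := Hyperplane.exists_adj_of_mem_hypCarrier hH
  obtain ⟨b, hvb, hb⟩ := Hyperplane.exists_adj_of_mem_hypCarrier hK
  obtain ⟨hab, hn⟩ := Hyperplane.not_adj_of_ne hne ha hb
  by_cases hq : ∃ q, q ≠ v ∧ X.Adj a q ∧ X.Adj b q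
  · exact .inl ⟨v, _, ha, _, hb, a, b, rfl, rfl, hva, hvb, hab, hn, hq⟩
  · exact .inr ⟨v, _, ha, _, hb, a, b, rfl, rfl, hva, hvb, hab, hn, hq⟩

/-- The carrier of a hyperplane lies on one side of any other hyperplane not crossing it. -/
lemma reachable_deleteEdges_of_mem_hypCarrier {H J : Hyperplane X} (hne : H ≠ J)
    (hcross : ¬ HypIntersect X H J) {v w : V} (hv : v ∈ hypCarrier X H)
    (hw : w ∈ hypCarrier X H) : (X.deleteEdges J.1).Reachable v w := by
  have hedge : ∀ {a b : V}, s(a, b) ∈ H.1 → (X.deleteEdges J.1).Reachable a b := by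
    intro a b h
    exact SimpleGraph.Adj.reachable (SimpleGraph.deleteEdges_adj.2
      ⟨H.mem_edgeSet h, fun hJ => hne (Hyperplane.eq_of_mem h hJ)⟩)
  have key : ∀ {e f : Sym2 V}, Relation.EqvGen (SideRel X) e f → e ∈ H.1 →
      ∀ v ∈ e, ∀ w ∈ f, (X.deleteEdges J.1).Reachable v w := by
    intro e f h
    induction h with
    | rel e f h =>
      intro he
      have hf := H.mem_of_eqvGen he (.rel _ _ h)
      rcases h with ⟨a, b, c, hab, hac, hbc, rfl, rfl⟩ |
        ⟨a, b, c, d, hab, hcd, hac, hbd, had, hbc, rfl, rfl⟩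
      · simp only [Sym2.mem_iff]
        rintro v (rfl | rfl) w (rfl | rfl)
        exacts [.rfl, hedge hf, (hedge he).symm, (hedge he).symm.trans (hedge hf)]
      · have hacJ : s(a, c) ∉ J.1 := fun hJ => hcross
          ⟨a, _, he, _, hJ, b, c, rfl, rfl, hab, hac, hbc,
            (Hyperplane.not_adj_of_ne hne he hJ).2, d, had.symm, hbd, hcd⟩
        have hR : (X.deleteEdges J.1).Reachable a c :=
          SimpleGraph.Adj.reachable (SimpleGraph.deleteEdges_adj.2 ⟨hac, hacJ⟩)
        simp only [Sym2.mem_iff]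
        rintro v (rfl | rfl) w (rfl | rfl)
        exacts [hR, hR.trans (hedge hf), (hedge he).symm.trans hR,
          ((hedge he).symm.trans hR).trans (hedge hf)]
    | refl e =>
      intro he
      induction e with | _ a b => ?_
      simp only [Sym2.mem_iff]
      rintro v (rfl | rfl) w (rfl | rfl)
      exacts [.rfl, hedge he, (hedge he).symm, .rfl]
    | symm e f h ih =>
      intro he v hv w hw
      exact (ih (H.mem_of_eqvGen he (h.symm _ _)) w hw v hv).symm
    | trans e f g h₁ _ ih₁ ih₂ =>
      intro he v hv w hw
      induction f with | _ a b => ?_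
      exact (ih₁ he v hv a (Sym2.mem_mk_left _ _)).trans
        (ih₂ (H.mem_of_eqvGen he h₁) a (Sym2.mem_mk_left _ _) w hw)
  obtain ⟨e, he, hve⟩ := hv
  obtain ⟨f, hf, hwf⟩ := hw
  refine key ?_ he v hve w hwf
  obtain ⟨_, g, _, rfl⟩ := H
  exact (he.symm _ _).trans _ _ _ hf

/-- `J` strictly separates the vertex `p` from the hyperplane `H`. -/
def IsBehind (X : SimpleGraph V) (p : V) (J H : Hyperplane X) : Prop :=
  H ≠ J ∧ ¬ HypIntersect X H J ∧
    ∀ v ∈ hypCarrier X H, ¬ (X.deleteEdges J.1).Reachable p v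

/-- A path of the crossing graph leaving the region behind `J` may be replaced by one starting
at `J`. -/
lemma IsBehind.exists_walk {p : V} {J : Hyperplane X} {K L : Hyperplane X}
    (W : (crossingGraph X).Walk K L) (hK : IsBehind X p J K) (hL : p ∈ hypCarrier X L) :
    ∃ W' : (crossingGraph X).Walk J L, W'.length ≤ W.length := by
  induction W with
  | nil => exact absurd .rfl (hK.2.2 p hL)
  | @cons K K' L hadj W ih =>
    by_cases hK' : IsBehind X p J K'
    · obtain ⟨W', hW'⟩ := ih hK' hL
      exact ⟨W', hW'.trans (by simp)⟩
    · obtain ⟨hKJ, hKi, hKr⟩ := hK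
      rw [crossingGraph, SimpleGraph.fromRel_adj] at hadj
      have hKK' : HypIntersect X K K' := hadj.2.elim id HypIntersect.symm
      have hne : K' ≠ J := by
        rintro rfl
        exact hKi hKK'
      have hcross : HypIntersect X K' J := by
        by_contra hcross
        refine hK' ⟨hne, hcross, fun v hv hpv => ?_⟩
        obtain ⟨x, hx, hx'⟩ := hKK'.exists_mem_hypCarrier
        exact hKr x hx (hpv.trans (reachable_deleteEdges_of_mem_hypCarrier hne hcross hv hx'))
      have hJK' : (crossingGraph X).Adj J K' := by
        rw [crossingGraph, SimpleGraph.fromRel_adj]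
        exact ⟨hne.symm, .inr hcross⟩
      exact ⟨.cons hJK' W, by simp⟩

/-- If intersecting hyperplanes never osculate, then the last hyperplane crossed by a shortest
path from `p` to the carrier of `H` strictly separates `p` from `H`. -/
lemma IsQuasiMedian.isBehind_of_closest (hX : IsQuasiMedian X)
    (hio : ∀ H K : Hyperplane X, HypIntersect X H K → ¬ HypOsculate X H K) {p q v : V}
    {H : Hyperplane X} (hv : v ∈ hypCarrier X H) (hq : q ∉ hypCarrier X H) (hqv : X.Adj q v)
    (hd : X.dist p v = X.dist p q + 1) :
    IsBehind X p ⟨hypClass X s(q, v), s(q, v), hqv, rfl⟩ H := by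
  set J : Hyperplane X := ⟨hypClass X s(q, v), s(q, v), hqv, rfl⟩
  have hJmem : s(q, v) ∈ J.1 := Relation.EqvGen.refl _
  have hne : H ≠ J := fun h => hq ⟨_, h ▸ hJmem, Sym2.mem_mk_left _ _⟩
  have hcross : ¬ HypIntersect X H J := by
    intro hi
    obtain ⟨a, hva, ha⟩ := Hyperplane.exists_adj_of_mem_hypCarrier hv
    have hJmem' : s(v, q) ∈ J.1 := by rwa [Sym2.eq_swap]
    obtain ⟨haq, hn⟩ := Hyperplane.not_adj_of_ne hne ha hJmem'
    refine hio H J hi ⟨v, _, ha, _, hJmem', a, q, rfl, rfl, hva, hqv.symm, haq, hn, ?_⟩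
    rintro ⟨r, hrv, har, hqr⟩
    exact hq ⟨s(q, r), H.mem_of_eqvGen ha (.rel _ _ (Or.inr
      ⟨v, a, q, r, hva, hqr, hqv.symm, har, hrv.symm, haq, rfl, rfl⟩)), Sym2.mem_mk_left _ _⟩
  refine ⟨hne, hcross, fun w hw hpw => hX.not_reachable_deleteEdges hqv hd ?_⟩
  exact hpw.trans (reachable_deleteEdges_of_mem_hypCarrier hne hcross hw hv)

/-- A hyperplane may be replaced by one adjacent to `p` without increasing its distance in the
crossing graph to the hyperplanes `A` and `B` adjacent to `p`. -/
lemma IsQuasiMedian.exists_hyperplane_adjacent (hX : IsQuasiMedian X)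
    (hio : ∀ H K : Hyperplane X, HypIntersect X H K → ¬ HypOsculate X H K) {p : V}
    {A B : Hyperplane X} (hA : p ∈ hypCarrier X A) (hB : p ∈ hypCarrier X B) (k : ℕ) :
    ∀ (H : Hyperplane X) (v : V), v ∈ hypCarrier X H → X.dist p v = k →
      ∀ (WA : (crossingGraph X).Walk H A) (WB : (crossingGraph X).Walk H B),
        ∃ (K : Hyperplane X) (WA' : (crossingGraph X).Walk K A)
          (WB' : (crossingGraph X).Walk K B),
          p ∈ hypCarrier X K ∧ WA'.length ≤ WA.length ∧ WB'.length ≤ WB.length := by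
  induction k with
  | zero =>
    intro H v hv hd WA WB
    obtain rfl := hX.connected.dist_eq_zero_iff.1 hd
    exact ⟨H, WA, WB, hv, le_rfl, le_rfl⟩
  | succ k ih =>
    intro H v hv hd WA WB
    have hpv : p ≠ v := by rintro rfl; simp at hd
    obtain ⟨q, hvq, hq⟩ := exists_adj_dist_succ hX.connected hpv
    by_cases hqH : q ∈ hypCarrier X H
    · exact ih H q hqH (by omega) WA WB
    · have hbehind := hX.isBehind_of_closest hio hv hqH hvq.symm hq.symm
      obtain ⟨WA', hWA'⟩ := hbehind.exists_walk WA hA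
      obtain ⟨WB', hWB'⟩ := hbehind.exists_walk WB hB
      obtain ⟨K, WA'', WB'', hK, h₁, h₂⟩ := ih _ q
        ⟨s(q, v), show s(q, v) ∈ hypClass X s(q, v) from Relation.EqvGen.refl _,
          Sym2.mem_mk_left _ _⟩ (by omega) WA' WB'
      exact ⟨K, WA'', WB'', hK, h₁.trans hWA', h₂.trans hWB'⟩

lemma Hyperplane.hypCarrier_nonempty (H : Hyperplane X) : (hypCarrier X H).Nonempty := by
  obtain ⟨_, e, _, rfl⟩ := H
  induction e with | _ a b => ?_
  exact ⟨a, s(a, b), Relation.EqvGen.refl _, Sym2.mem_mk_left _ _⟩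

end Hyperplanes

section Orbits

variable {V : Type*} {G : Type*} [Group G] {X : SimpleGraph V}

lemma GraphAction.hypImage_one (α : GraphAction G X) (S : Set (Sym2 V)) :
    α.hypImage 1 S = S := by
  have : α.act 1 = id := funext α.act_one
  simp [GraphAction.hypImage, this]

lemma GraphAction.hypImage_mul (α : GraphAction G X) (g h : G) (S : Set (Sym2 V)) :
    α.hypImage (g * h) S = α.hypImage g (α.hypImage h S) := by
  have : α.act (g * h) = α.act g ∘ α.act h := funext (α.act_mul g h)
  simp [GraphAction.hypImage, this, Set.image_image, Sym2.map_map]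

lemma sameOrbit_equivalence (α : GraphAction G X) : Equivalence (SameOrbit α) where
  refl H := ⟨1, (α.hypImage_one _).symm⟩
  symm := by
    rintro H K ⟨g, hg⟩
    exact ⟨g⁻¹, by rw [hg, ← α.hypImage_mul, inv_mul_cancel, α.hypImage_one]⟩
  trans := by
    rintro H K L ⟨g, hg⟩ ⟨h, hh⟩
    exact ⟨h * g, by rw [hh, hg, α.hypImage_mul]⟩

end Orbits

/-- **Lemma (no long osculation).** If a group `G` acts specially on a quasi-median graph
`X` with exactly `N` orbits of hyperplanes, and `A`, `B` are osculating hyperplanes in the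
same connected component of the crossing graph `ΔX`, then `d_{ΔX}(A,B) ≤ max {2, N-1}`. -/
theorem osculating_distance_bound {V : Type*} {G : Type*} [Group G]
    (X : SimpleGraph V) (hX : IsQuasiMedian X) (α : GraphAction G X) (hsp : IsSpecial α)
    (N : ℕ) (hfin : Finite (HypOrbit α)) (hN : Nat.card (HypOrbit α) = N)
    (A B : Hyperplane X) (hosc : HypOsculate X A B)
    (hreach : (crossingGraph X).Reachable A B) :
    (crossingGraph X).dist A B ≤ max 2 (N - 1) := by
  obtain ⟨p, e, he, e', he', a, b, rfl, rfl, -⟩ := hosc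
  have hA : p ∈ hypCarrier X A := ⟨_, he, Sym2.mem_mk_left _ _⟩
  have hB : p ∈ hypCarrier X B := ⟨_, he', Sym2.mem_mk_left _ _⟩
  have hio : ∀ H K : Hyperplane X, HypIntersect X H K → ¬ HypOsculate X H K :=
    fun H K h => hsp.2 H K H h ((sameOrbit_equivalence α).refl H)
  obtain ⟨W, hW⟩ := hreach.exists_walk_length_eq_dist
  set n := (crossingGraph X).dist A B
  have key : ∀ i : Fin (n + 1), ∃ K : Hyperplane X, p ∈ hypCarrier X K ∧
      (crossingGraph X).dist K A = i := by
    intro i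
    obtain ⟨v, hv⟩ := (W.getVert i).hypCarrier_nonempty
    obtain ⟨K, WA, WB, hK, h₁, h₂⟩ := hX.exists_hyperplane_adjacent hio hA hB _ _ v hv rfl
      (W.take i).reverse (W.drop i)
    refine ⟨K, hK, ?_⟩
    obtain ⟨W', hW'⟩ := WA.reachable.exists_walk_length_eq_dist
    have h₃ := SimpleGraph.dist_le (W'.reverse.append WB)
    have h₄ := SimpleGraph.dist_le WA
    have := i.2
    simp only [SimpleGraph.Walk.length_append, SimpleGraph.Walk.length_reverse,
      SimpleGraph.Walk.take_length, SimpleGraph.Walk.drop_length] at h₁ h₂ h₃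
    omega
  choose K hK hKd using key
  have hinj : Function.Injective (β := HypOrbit α) fun i => Quot.mk (SameOrbit α) (K i) := by
    intro i j hij
    by_contra hne
    have hKne : K i ≠ K j := by
      intro h
      apply hne
      have h' := hKd i
      rw [h, hKd j] at h'
      exact Fin.ext h'.symm
    have hso : SameOrbit α (K i) (K j) :=
      (sameOrbit_equivalence α).eqvGen_iff.1 (Quot.eqvGen_exact hij)
    exact hsp.1 _ _ hso hKne (intersect_or_osculate hKne (hK i) (hK j))
  have hcard := Nat.card_le_card_of_injective _ hinj
  rw [hN, Nat.card_fin] at hcard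
  omega

end QM
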